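/- In the setting of the Hessian identity for the negative log marginal likelihood f(α) = −log ∫_{[0,2π]^n} exp(−‖I − T(s)Φα‖₂²/(2σ²)) π(s) ds (with W a real D×2L matrix satisfying WᵀW = 1, T(s) = W R(s) Wᵀ, R(s) the block-diagonal rotation matrix with angles ω_l·s, Φ a real D×K matrix, σ > 0, and π a continuous strictly positive density on [0,2π]^n), the Hessian of f at every α ∈ ℝ^K is bounded above in the Loewner (positive semidefinite) order by (1/σ²) Φᵀ W Wᵀ Φ; that is, (1/σ²) Φᵀ W Wᵀ Φ − ∇²f(α) is a positive semidefinite matrix. In particular, xᵀ ∇²f(α) x ≤ (1/σ²) ‖Wᵀ Φ x‖₂² for all x ∈ ℝ^K. -/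

import Mathlib

open Matrix Real MeasureTheory

/-- The 2×2 rotation matrix of angle `θ`. -/
noncomputable def rotBlock (θ : ℝ) : Matrix (Fin 2) (Fin 2) ℝ :=
  !![Real.cos θ, -Real.sin θ; Real.sin θ, Real.cos θ]

/-- The 2L×2L block-diagonal matrix whose l-th 2×2 diagonal block is the
rotation matrix of angle `ω l · s`. -/
noncomputable def blockRot {n L : ℕ} (ω : Fin L → Fin n → ℝ) (s : Fin n → ℝ) :
    Matrix (Fin L × Fin 2) (Fin L × Fin 2) ℝ :=
  fun p q => if p.1 = q.1 then rotBlock (∑ i, ω p.1 i * s i) p.2 q.2 else 0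


lemma aux_line {E : Type*} [NormedAddCommGroup E] [NormedSpace ℝ E] {g : E → ℝ}
    (hg : ContDiff ℝ 2 g) (α x : E) :
    iteratedDeriv 2 (fun t : ℝ => g (α + t • x)) 0 = fderiv ℝ (fderiv ℝ g) α x x := by
  have h1 : ∀ t : ℝ, HasDerivAt (fun t : ℝ => α + t • x) x t := fun t => by
    simpa using ((hasDerivAt_id t).smul_const x).const_add α
  have hd : Differentiable ℝ g := hg.differentiable (by norm_num)
  have hd2 : Differentiable ℝ (fderiv ℝ g) :=
    (hg.fderiv_right (m := 1) (by norm_num)).differentiable (by norm_num)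
  have e1 : deriv (fun t : ℝ => g (α + t • x)) = fun t => fderiv ℝ g (α + t • x) x := by
    funext t
    exact ((hd _).hasFDerivAt.comp_hasDerivAt t (h1 t)).deriv
  rw [iteratedDeriv_succ, iteratedDeriv_one, e1]
  have h2 := (hd2 (α + (0:ℝ) • x)).hasFDerivAt.comp_hasDerivAt (0:ℝ) (h1 0)
  have h3 := (h2.clm_apply (hasDerivAt_const (0:ℝ) x)).deriv
  simpa using h3

lemma aux_contDiff {X E : Type*} [TopologicalSpace X] [CompactSpace X] [MeasurableSpace X]
    [BorelSpace X] [NormedAddCommGroup E] [NormedSpace ℝ E] (μ : Measure X) [IsFiniteMeasure μ]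
    (B : E →L[ℝ] C(X, ℝ)) :
    ContDiff ℝ 2 (fun α => ∫ s, Real.exp (B α s) ∂μ) := by
  have hint : ∀ h : C(X, ℝ), Integrable h μ := fun h =>
    h.continuous.integrable_of_hasCompactSupport (HasCompactSupport.of_compactSpace h)
  let L0 : C(X, ℝ) →ₗ[ℝ] ℝ :=
    { toFun := fun h => ∫ s, h s ∂μ
      map_add' := fun h k => by simpa using integral_add (hint h) (hint k)
      map_smul' := fun c h => by simpa using integral_const_mul c _ }
  let L : C(X, ℝ) →L[ℝ] ℝ := L0.mkContinuous (μ.real Set.univ) (fun h => by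
    have := norm_integral_le_of_norm_le_const (μ := μ) (f := h) (C := ‖h‖)
      (Filter.Eventually.of_forall fun s => h.norm_coe_le_norm s)
    rw [mul_comm]
    exact this)
  have hexp : ContDiff ℝ 2 (NormedSpace.exp : C(X, ℝ) → C(X, ℝ)) :=
    contDiff_iff_contDiffAt.2 fun x => (NormedSpace.exp_analytic (𝕂 := ℝ) x).contDiffAt
  have := L.contDiff.comp (hexp.comp B.contDiff)
  convert this using 1
  funext α
  change _ = ∫ s, (NormedSpace.exp (B α)) s ∂μ
  rw [NormedSpace.exp_continuousMap_eq]
  simp [Real.exp_eq_exp_ℝ]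

lemma aux_cgf {X E : Type*} [TopologicalSpace X] [CompactSpace X] [MeasurableSpace X]
    [BorelSpace X] [NormedAddCommGroup E] [NormedSpace ℝ E] (μ : Measure X) [IsFiniteMeasure μ]
    (hμ : μ ≠ 0) (B : E →L[ℝ] C(X, ℝ)) :
    ContDiff ℝ 2 (fun α => Real.log (∫ s, Real.exp (B α s) ∂μ)) ∧
    ∀ α x, 0 ≤ fderiv ℝ (fderiv ℝ (fun α => Real.log (∫ s, Real.exp (B α s) ∂μ))) α x x := by
  have hint : ∀ (μ : Measure X) [IsFiniteMeasure μ] (h : C(X, ℝ)), Integrable (fun s => Real.exp (h s)) μ := fun μ _ h =>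
    (by fun_prop : Continuous fun s => Real.exp (h s)).integrable_of_hasCompactSupport
      (HasCompactSupport.of_compactSpace _)
  have hpos : ∀ α, 0 < ∫ s, Real.exp (B α s) ∂μ := fun α => by
    have : NeZero μ := ⟨hμ⟩
    exact integral_exp_pos (hint μ _)
  have hC : ContDiff ℝ 2 (fun α => Real.log (∫ s, Real.exp (B α s) ∂μ)) :=
    (aux_contDiff μ B).log fun α => (hpos α).ne'
  refine ⟨hC, fun α x => ?_⟩
  rw [← aux_line hC]
  let μ' := μ.withDensity (fun s => ENNReal.ofReal (Real.exp (B α s)))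
  have : IsFiniteMeasure μ' := isFiniteMeasure_withDensity_ofReal (hint μ (B α)).2
  have e : (fun t : ℝ => Real.log (∫ s, Real.exp (B (α + t • x) s) ∂μ))
      = ProbabilityTheory.cgf (fun s => B x s) μ' := by
    funext t
    rw [ProbabilityTheory.cgf, ProbabilityTheory.mgf,
      integral_withDensity_eq_integral_toReal_smul (by fun_prop) (by simp)]
    congr 2
    funext s
    rw [ENNReal.toReal_ofReal (Real.exp_pos _).le, smul_eq_mul, ← Real.exp_add]
    simp
  rw [e]
  have hu : ProbabilityTheory.integrableExpSet (fun s => B x s) μ' = Set.univ := by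
    ext t
    simpa [ProbabilityTheory.integrableExpSet] using hint μ' (t • B x)
  rw [ProbabilityTheory.iteratedDeriv_two_cgf_eq_integral (by simp [hu])]
  exact div_nonneg (integral_nonneg fun s => by positivity) ProbabilityTheory.mgf_nonneg

lemma aux_rot {n L : ℕ} (ω : Fin L → Fin n → ℝ) (s : Fin n → ℝ) :
    (blockRot ω s)ᵀ * blockRot ω s = 1 := by
  ext ⟨l, a⟩ ⟨m, b⟩
  simp only [Matrix.mul_apply, Fintype.sum_prod_type, Matrix.transpose_apply, blockRot]
  by_cases h : l = m
  · subst h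
    rw [Finset.sum_eq_single l (by intro k _ hk; simp [hk]) (by simp)]
    have := Real.sin_sq_add_cos_sq (∑ i, ω l i * s i)
    fin_cases a <;> fin_cases b <;> simp [rotBlock, Matrix.one_apply] <;> nlinarith
  · rw [Matrix.one_apply_ne (by simp [h])]
    apply Finset.sum_eq_zero
    intro k _
    by_cases hk : k = l
    · subst hk; simp [h]
    · simp [hk]

lemma aux_rot_cont {n L : ℕ} (ω : Fin L → Fin n → ℝ) : Continuous (blockRot ω) := by
  refine continuous_matrix fun p q => ?_
  rcases p with ⟨l, a⟩
  rcases q with ⟨m, b⟩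
  unfold blockRot
  by_cases h : l = m
  · simp only [h, if_true]
    fin_cases a <;> fin_cases b <;> simp [rotBlock] <;> fun_prop
  · simp only [h, if_false]
    fun_prop

lemma aux_sq {ι κ : Type*} [Fintype ι] [Fintype κ] (A : Matrix ι κ ℝ) (v : κ → ℝ) :
    ∑ i, (A.mulVec v i) ^ 2 = v ⬝ᵥ ((Aᵀ * A).mulVec v) := by
  rw [← Matrix.mulVec_mulVec, Matrix.dotProduct_mulVec, Matrix.vecMul_transpose]
  simp [dotProduct, sq]

theorem stmt_16 (n D L K : ℕ) (hn : 0 < n) (hD : 0 < D) (hL : 0 < L) (hK : 0 < K)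
    (hDL : 2 * L ≤ D)
    (ω : Fin L → Fin n → ℝ) (σ : ℝ) (hσ : 0 < σ)
    (W : Matrix (Fin D) (Fin L × Fin 2) ℝ) (hW : Wᵀ * W = 1)
    (Φ : Matrix (Fin D) (Fin K) ℝ) (I : Fin D → ℝ)
    (T : (Fin n → ℝ) → Matrix (Fin D) (Fin D) ℝ)
    (hT : ∀ s, T s = W * blockRot ω s * Wᵀ)
    (Kset : Set (Fin n → ℝ))
    (hKset : Kset = Set.univ.pi fun _ : Fin n => Set.Icc (0 : ℝ) (2 * Real.pi))
    (prior : (Fin n → ℝ) → ℝ)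
    (hprior_cont : ContinuousOn prior Kset)
    (hprior_pos : ∀ s ∈ Kset, 0 < prior s)
    (f : (Fin K → ℝ) → ℝ)
    (hf : f = fun α => -Real.log (∫ s in Kset,
      Real.exp (-(∑ i, (I i - (T s * Φ).mulVec α i) ^ 2) / (2 * σ ^ 2)) * prior s)) :
    ContDiff ℝ 2 f ∧
      (∀ α : Fin K → ℝ,
        (((1 / σ ^ 2) • (Φᵀ * W * Wᵀ * Φ) : Matrix (Fin K) (Fin K) ℝ) -
          Matrix.of fun i j =>
            fderiv ℝ (fderiv ℝ f) α (Pi.single i 1 : Fin K → ℝ)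
              (Pi.single j 1 : Fin K → ℝ)).PosSemidef) ∧
      ∀ (α x : Fin K → ℝ),
        fderiv ℝ (fderiv ℝ f) α x x ≤ (1 / σ ^ 2) * ∑ j, ((Wᵀ * Φ).mulVec x j) ^ 2 := by
  classical
  have hcompact : IsCompact Kset := by
    rw [hKset]; exact isCompact_univ_pi fun _ => isCompact_Icc
  have hmeas : MeasurableSet Kset := hcompact.measurableSet
  have hσ2 : σ ^ 2 ≠ 0 := by positivity
  have : CompactSpace Kset := isCompact_iff_compactSpace.1 hcompact
  have hTc : Continuous T := by
    have : T = fun s => W * blockRot ω s * Wᵀ := funext hT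
    rw [this]
    have := aux_rot_cont ω
    fun_prop
  -- the reference measure on the compact cube
  let ν : Measure Kset := Measure.comap Subtype.val volume
  have hνuniv : ν Set.univ = volume Kset := by
    rw [comap_subtype_coe_apply hmeas]; simp
  have : IsFiniteMeasure ν := ⟨by rw [hνuniv]; exact hcompact.measure_lt_top⟩
  have hν0 : ν ≠ 0 := by
    intro h
    rw [h, hKset, volume_pi_pi] at hνuniv
    have h0 := Finset.prod_eq_zero_iff.1 hνuniv.symm
    obtain ⟨_, _, h1⟩ := h0
    rw [Real.volume_Icc, ENNReal.ofReal_eq_zero] at h1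
    linarith [Real.pi_pos]
  have hpc : Continuous fun s : Kset => prior s := hprior_cont.domRestrict
  have hpm : Measurable fun s : Kset => ENNReal.ofReal (prior s) := hpc.measurable.ennreal_ofReal
  let μ : Measure Kset := ν.withDensity (fun s => ENNReal.ofReal (prior s))
  have : IsFiniteMeasure μ := isFiniteMeasure_withDensity_ofReal
    (hpc.integrable_of_hasCompactSupport (HasCompactSupport.of_compactSpace _)).2
  have hμ0 : μ ≠ 0 := by
    intro h
    have h2 := (withDensity_eq_zero_iff hpm.aemeasurable).1 h
    have h3 : ∀ᵐ s ∂ν, False := by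
      filter_upwards [h2] with s hs
      have := hprior_pos s s.2
      simp at hs
      linarith
    exact hν0 (by simpa using h3)
  let b : Fin K → C(Kset, ℝ) := fun k =>
    ⟨fun s => (1 / σ ^ 2) * ∑ d, I d * (T s * Φ) d k, by
      have h : Continuous fun s : Kset => T s * Φ :=
        (hTc.comp continuous_subtype_val).matrix_mul continuous_const
      have h' : ∀ d, Continuous fun s : Kset => (T s * Φ) d k := fun d => h.matrix_elem d k
      fun_prop⟩
  let B : (Fin K → ℝ) →L[ℝ] C(Kset, ℝ) :=
    ∑ k, (ContinuousLinearMap.proj (R := ℝ) (φ := fun _ : Fin K => ℝ) k).smulRight (b k)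
  have hB : ∀ α (s : Kset), B α s = (1 / σ ^ 2) * ∑ d, I d * (T s * Φ).mulVec α d := by
    intro α s
    simp only [B, b, ContinuousLinearMap.sum_apply, ContinuousMap.sum_apply,
      ContinuousLinearMap.smulRight_apply, ContinuousMap.smul_apply, ContinuousLinearMap.proj_apply,
      ContinuousMap.coe_mk, Matrix.mulVec, dotProduct, Finset.mul_sum, smul_eq_mul]
    rw [Finset.sum_comm]
    refine Finset.sum_congr rfl fun d _ => Finset.sum_congr rfl fun k _ => by ring
  obtain ⟨hg, hg2⟩ := aux_cgf μ hμ0 B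
  set g : (Fin K → ℝ) → ℝ := fun α => Real.log (∫ s, Real.exp (B α s) ∂μ) with hgdef
  let q : (Fin K → ℝ) → ℝ := fun α =>
    (∑ i, I i ^ 2) / (2 * σ ^ 2) + (∑ j, ((Wᵀ * Φ).mulVec α j) ^ 2) / (2 * σ ^ 2)
  have hnorm : ∀ s α, ∑ i, ((T s * Φ).mulVec α i) ^ 2 = ∑ j, ((Wᵀ * Φ).mulVec α j) ^ 2 := by
    intro s α
    rw [aux_sq, aux_sq, hT]
    congr 2
    calc (W * blockRot ω s * Wᵀ * Φ)ᵀ * (W * blockRot ω s * Wᵀ * Φ)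
        = Φᵀ * W * ((blockRot ω s)ᵀ * (Wᵀ * W) * blockRot ω s) * Wᵀ * Φ := by
          simp only [Matrix.transpose_mul, Matrix.transpose_transpose, Matrix.mul_assoc]
      _ = (Wᵀ * Φ)ᵀ * (Wᵀ * Φ) := by
          rw [hW, Matrix.mul_one, aux_rot]
          simp only [Matrix.transpose_mul, Matrix.transpose_transpose, Matrix.mul_assoc,
            Matrix.mul_one, Matrix.one_mul]
  have hIpos : ∀ α, 0 < ∫ s, Real.exp (B α s) ∂μ := fun α => by
    have : NeZero μ := ⟨hμ0⟩
    exact integral_exp_pos ((by fun_prop : Continuous fun s => Real.exp (B α s)).integrable_of_hasCompactSupport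
      (HasCompactSupport.of_compactSpace _))
  have hfq : f = fun α => q α - g α := by
    rw [hf]
    funext α
    have e1 : ∫ s in Kset, Real.exp (-(∑ i, (I i - (T s * Φ).mulVec α i) ^ 2) / (2 * σ ^ 2)) * prior s
        = Real.exp (-q α) * ∫ s, Real.exp (B α s) ∂μ := by
      rw [← integral_subtype_comap hmeas,
        integral_withDensity_eq_integral_toReal_smul hpm (by simp),
        ← integral_const_mul]
      refine integral_congr_ae (Filter.Eventually.of_forall fun s => ?_)
      simp only [smul_eq_mul]
      rw [ENNReal.toReal_ofReal (hprior_pos s s.2).le, mul_left_comm, ← Real.exp_add, mul_comm,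
        hB]
      congr 2
      simp only [q]
      rw [← hnorm s α]
      simp only [sub_sq, Finset.sum_add_distrib, Finset.sum_sub_distrib, mul_assoc,
        ← Finset.mul_sum]
      field_simp
      ring
    rw [e1, Real.log_mul (Real.exp_pos _).ne' (hIpos α).ne', Real.log_exp]
    ring
  have hq : ContDiff ℝ 2 q := by
    have : ∀ j, ContDiff ℝ 2 fun α : Fin K → ℝ => (Wᵀ * Φ).mulVec α j := fun j => by
      unfold Matrix.mulVec dotProduct
      fun_prop
    unfold q
    fun_prop
  have hfC : ContDiff ℝ 2 f := by rw [hfq]; exact hq.sub hg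
  have hq2 : ∀ α x, fderiv ℝ (fderiv ℝ q) α x x =
      (1 / σ ^ 2) * ∑ j, ((Wᵀ * Φ).mulVec x j) ^ 2 := by
    intro α x
    rw [← aux_line hq]
    have e : (fun t : ℝ => q (α + t • x)) = fun t : ℝ => q α +
        (∑ j, (Wᵀ * Φ).mulVec α j * (Wᵀ * Φ).mulVec x j) / σ ^ 2 * t +
        (∑ j, ((Wᵀ * Φ).mulVec x j) ^ 2) / (2 * σ ^ 2) * t ^ 2 := by
      funext t
      simp only [q, Matrix.mulVec_add, Matrix.mulVec_smul, Pi.add_apply, Pi.smul_apply,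
        smul_eq_mul, add_sq, Finset.sum_add_distrib, mul_pow, ← Finset.mul_sum]
      have : ∑ j, 2 * (Wᵀ * Φ).mulVec α j * (t * (Wᵀ * Φ).mulVec x j) =
          2 * t * ∑ j, (Wᵀ * Φ).mulVec α j * (Wᵀ * Φ).mulVec x j := by
        rw [Finset.mul_sum]
        exact Finset.sum_congr rfl fun j _ => by ring
      rw [this]
      field_simp
      ring
    rw [e]
    generalize (∑ j, (Wᵀ * Φ).mulVec α j * (Wᵀ * Φ).mulVec x j) / σ ^ 2 = u
    generalize q α = w
    generalize (∑ j, ((Wᵀ * Φ).mulVec x j) ^ 2) = v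
    have d1 : deriv (fun t : ℝ => w + u * t + v / (2 * σ ^ 2) * t ^ 2) =
        fun t => u + v / (2 * σ ^ 2) * (2 * t) := by
      funext t
      have := (((hasDerivAt_id t).const_mul u).const_add w).add
        (((hasDerivAt_id t).pow 2).const_mul (v / (2 * σ ^ 2)))
      have h := this.deriv
      simpa [Pi.add_def] using h
    rw [iteratedDeriv_succ, iteratedDeriv_one, d1]
    have := ((((hasDerivAt_id (0:ℝ)).const_mul 2).const_mul (v / (2 * σ ^ 2))).const_add u).deriv
    simp only [id] at this
    rw [this]
    field_simp
  have hle : ∀ (α x : Fin K → ℝ),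
      fderiv ℝ (fderiv ℝ f) α x x ≤ (1 / σ ^ 2) * ∑ j, ((Wᵀ * Φ).mulVec x j) ^ 2 := by
    intro α x
    have e := hq2 α x
    have e2 : q = fun α => f α + g α := by rw [hfq]; funext α; ring
    rw [← aux_line hfC, ← e, ← aux_line hq]
    have h2 := hg2 α x
    rw [← aux_line hg] at h2
    have hl : ContDiff ℝ 2 fun t : ℝ => α + t • x := by fun_prop
    have h3 : iteratedDeriv 2 (fun t : ℝ => q (α + t • x)) 0 =
        iteratedDeriv 2 (fun t : ℝ => f (α + t • x)) 0 +
        iteratedDeriv 2 (fun t : ℝ => g (α + t • x)) 0 := by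
      rw [e2]
      exact iteratedDeriv_fun_add (hfC.comp hl).contDiffAt (hg.comp hl).contDiffAt
    linarith
  refine ⟨hfC, fun α => ?_, hle⟩
  refine Matrix.PosSemidef.of_dotProduct_mulVec_nonneg ?_ fun x => ?_
  · have hsymm : IsSymmSndFDerivAt ℝ f α := hfC.contDiffAt.isSymmSndFDerivAt (by simp)
    ext i j
    simp only [Matrix.conjTranspose_apply, Matrix.sub_apply, Matrix.smul_apply, Matrix.of_apply,
      star_trivial]
    rw [hsymm (Pi.single i 1) (Pi.single j 1)]
    congr 2
    have : (Φᵀ * W * Wᵀ * Φ)ᵀ = Φᵀ * W * Wᵀ * Φ := by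
      simp only [Matrix.transpose_mul, Matrix.transpose_transpose, Matrix.mul_assoc]
    conv_rhs => rw [← this]
    rfl
  · have hx : x = ∑ i, x i • (Pi.single i 1 : Fin K → ℝ) := by
      funext k
      simp [Finset.sum_apply, Pi.single_apply]
    have h1 : x ⬝ᵥ ((Matrix.of fun i j => fderiv ℝ (fderiv ℝ f) α (Pi.single i 1 : Fin K → ℝ)
              (Pi.single j 1 : Fin K → ℝ)).mulVec x) = fderiv ℝ (fderiv ℝ f) α x x := by
      conv_rhs => rw [hx]
      simp only [map_sum, map_smul, ContinuousLinearMap.sum_apply, ContinuousLinearMap.smul_apply,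
        dotProduct, Matrix.mulVec, Matrix.of_apply, smul_eq_mul, Finset.mul_sum]
      rw [Finset.sum_comm]
      refine Finset.sum_congr rfl fun i _ => Finset.sum_congr rfl fun j _ => by ring
    have h2 : (Φᵀ * W * Wᵀ * Φ) = (Wᵀ * Φ)ᵀ * (Wᵀ * Φ) := by
      simp only [Matrix.transpose_mul, Matrix.transpose_transpose, Matrix.mul_assoc]
    rw [star_trivial, Matrix.sub_mulVec, dotProduct_sub, h1, Matrix.smul_mulVec, dotProduct_smul,
      h2, ← aux_sq, smul_eq_mul]
    linarith [hle α x]
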